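/- arXiv:2002.07423 — 3 statements merged into one kernel-verified Lean document; each statement's English description precedes it below -/
import Mathlib

section
/- Every homogeneous countable dense homogeneous topological space containing a copy of the Cantor set is a Baire space. -/
open TopologicalSpace

/-- `X` is countable dense homogeneous. -/
def CDH (X : Type*) [TopologicalSpace X] : Prop :=
  SeparableSpace X ∧
    ∀ D D' : Set X, D.Countable → Dense D → D'.Countable → Dense D' →
      ∃ h : X ≃ₜ X, h '' D = D'

namespace CDHProof

open Set Filter Topology

/-- Relatively discrete set. -/
def Disc {Y : Type*} [TopologicalSpace Y] (S : Set Y) : Prop :=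
  ∀ s ∈ S, ∃ U : Set Y, IsOpen U ∧ s ∈ U ∧ U ∩ S ⊆ {s}

/-- Flip the coordinate `n`. -/
def flip (x : ℕ → Bool) (n : ℕ) : ℕ → Bool := Function.update x n (!(x n))

lemma flip_ne (x : ℕ → Bool) (n : ℕ) : flip x n ≠ x := by
  intro h
  have := congrFun h n
  simp [flip] at this

lemma flip_tendsto (x : ℕ → Bool) : Tendsto (flip x) atTop (𝓝 x) := by
  rw [tendsto_pi_nhds]
  intro i
  apply tendsto_const_nhds.congr'
  filter_upwards [eventually_gt_atTop i] with n hn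
  simp [flip, Function.update_of_ne hn.ne]

lemma flip_closure (x : ℕ → Bool) : x ∈ closure (range (flip x)) :=
  mem_closure_of_tendsto (flip_tendsto x) (Eventually.of_forall fun n => mem_range_self n)

lemma flip_disc (x : ℕ → Bool) : Disc (range (flip x)) := by
  rintro _ ⟨n, rfl⟩
  refine ⟨(fun y : ℕ → Bool => y n) ⁻¹' {!(x n)}, ?_, ?_, ?_⟩
  · exact (isOpen_discrete _).preimage (continuous_apply n)
  · simp [flip]
  · rintro _ ⟨h, ⟨m, rfl⟩⟩
    by_cases hm : m = n
    · subst hm; rfl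
    · exfalso
      simp [flip, Function.update_of_ne (Ne.symm hm)] at h

/-- Finitely supported points. -/
def Q : Set (ℕ → Bool) := range (fun s : Finset ℕ => fun n => decide (n ∈ s))

lemma Q_countable : Q.Countable := countable_range _

lemma Q_flip {x : ℕ → Bool} (hx : x ∈ Q) (n : ℕ) : flip x n ∈ Q := by
  obtain ⟨s, rfl⟩ := hx
  refine ⟨symmDiff s {n}, ?_⟩
  funext m
  by_cases h : m = n
  · subst h; simp [flip, Finset.mem_symmDiff]
  · simp [flip, Finset.mem_symmDiff, h]

lemma Q_dense : Dense Q := by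
  intro x
  have : Tendsto (fun N : ℕ => fun n => decide (n ∈ (Finset.range N).filter (fun i => x i = true)))
      atTop (𝓝 x) := by
    rw [tendsto_pi_nhds]
    intro i
    apply tendsto_const_nhds.congr'
    filter_upwards [eventually_gt_atTop i] with n hn
    simp [hn]
  exact mem_closure_of_tendsto this (Eventually.of_forall fun n => ⟨_, rfl⟩)

lemma disc_nowhere {A : Set (ℕ → Bool)} (hA : Disc A) : Dense (closure A)ᶜ := by
  rw [← interior_eq_empty_iff_dense_compl, eq_empty_iff_forall_notMem]
  intro x hx
  have hxc : x ∈ closure A := interior_subset hx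
  obtain ⟨a, haW, haA⟩ := mem_closure_iff.1 hxc _ isOpen_interior hx
  obtain ⟨U, hU, haU, hUA⟩ := hA a haA
  obtain ⟨b, ⟨hbU, hbW⟩, ⟨n, rfl⟩⟩ :=
    mem_closure_iff.1 (flip_closure a) _ (hU.inter isOpen_interior) ⟨haU, haW⟩
  have hbc : flip a n ∈ closure A := interior_subset hbW
  obtain ⟨c, ⟨hcU, hca⟩, hcA⟩ := mem_closure_iff.1 hbc (U ∩ {a}ᶜ)
    (hU.inter isOpen_compl_singleton) ⟨hbU, flip_ne a n⟩
  exact hca (hUA ⟨hcU, hcA⟩)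

lemma disc_preimage {Y Z : Type*} [TopologicalSpace Y] [TopologicalSpace Z] {g : Y → Z}
    (hg : Continuous g) (hi : Function.Injective g) {S : Set Z} (hS : Disc S) :
    Disc (g ⁻¹' S) := by
  intro s hs
  obtain ⟨U, hU, hsU, h⟩ := hS _ hs
  exact ⟨g ⁻¹' U, hU.preimage hg, hsU, fun y hy => hi (h ⟨hy.1, hy.2⟩)⟩

lemma disc_image {Y Z : Type*} [TopologicalSpace Y] [TopologicalSpace Z] {g : Y → Z}
    (hg : IsEmbedding g) {S : Set Y} (hS : Disc S) : Disc (g '' S) := by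
  rintro _ ⟨s, hs, rfl⟩
  obtain ⟨U, hU, hsU, h⟩ := hS _ hs
  obtain ⟨V, hV, rfl⟩ := hg.isInducing.isOpen_iff.1 hU
  refine ⟨V, hV, hsU, ?_⟩
  rintro _ ⟨hy, ⟨t, ht, rfl⟩⟩
  rw [h ⟨hy, ht⟩]; rfl

/-- A homogeneous separable space that is not Baire is meagre in itself. -/
lemma exists_seq {X : Type*} [TopologicalSpace X] [Nonempty X] [SeparableSpace X]
    (hhom : ∀ x y : X, ∃ h : X ≃ₜ X, h x = y) (hB : ¬ BaireSpace X) :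
    ∃ V : ℕ → Set X, (∀ n, IsOpen (V n)) ∧ (∀ n, Dense (V n)) ∧ Antitone V ∧ ⋂ n, V n = ∅ := by
  have h1 : ∃ f : ℕ → Set X, (∀ n, IsOpen (f n)) ∧ (∀ n, Dense (f n)) ∧ ¬ Dense (⋂ n, f n) := by
    by_contra hcon
    push Not at hcon
    exact hB ⟨fun f ho hd => hcon f ho hd⟩
  obtain ⟨f, fo, fd, hf⟩ := h1
  obtain ⟨U, hU, ⟨u, hu⟩, hUe⟩ : ∃ U : Set X, IsOpen U ∧ U.Nonempty ∧ ¬ (U ∩ ⋂ n, f n).Nonempty := by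
    rw [dense_iff_inter_open] at hf
    push Not at hf
    obtain ⟨U, a, b, c⟩ := hf
    exact ⟨U, a, b, by simpa [Set.not_nonempty_iff_eq_empty] using c⟩
  choose h hh using fun m : ℕ => hhom (denseSeq X m) u
  -- the dense open sets, indexed by `Option (ℕ × ℕ)`
  let g : Option (ℕ × ℕ) → Set X := fun o =>
    match o with
    | none => ⋃ m, (h m) ⁻¹' U
    | some p => (h p.1) ⁻¹' (f p.2)
  have go : ∀ o, IsOpen (g o) := by
    rintro (_ | ⟨m, n⟩)
    · exact isOpen_iUnion fun m => hU.preimage (h m).continuous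
    · exact (fo n).preimage (h m).continuous
  have gd : ∀ o, Dense (g o) := by
    rintro (_ | ⟨m, n⟩)
    · refine (denseRange_denseSeq X).mono ?_
      rintro _ ⟨m, rfl⟩
      exact mem_iUnion.2 ⟨m, by simpa [hh] using hu⟩
    · exact (fd n).preimage (h m).isOpenMap
  have ge : ∀ x, ∃ o, x ∉ g o := by
    intro x
    by_contra hcon
    push Not at hcon
    obtain ⟨m, hm⟩ := mem_iUnion.1 (hcon none)
    exact hUe ⟨h m x, hm, mem_iInter.2 fun n => hcon (some (m, n))⟩
  obtain ⟨e, he⟩ := exists_surjective_nat (Option (ℕ × ℕ))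
  refine ⟨fun n => ⋂ i ∈ Finset.range (n+1), g (e i), ?_, ?_, ?_, ?_⟩
  · intro n
    exact isOpen_biInter_finset fun i _ => go _
  · have key : ∀ s : Finset ℕ, Dense (⋂ i ∈ s, g (e i)) := by
      intro s
      induction s using Finset.induction_on with
      | empty => simp
      | insert a s ha ih =>
        rw [Finset.set_biInter_insert]
        exact (gd _).inter_of_isOpen_left ih (go _)
    intro n
    exact key _
  · intro a b hab x hx
    simp only [mem_iInter, Finset.mem_range] at hx ⊢
    intro i hi
    exact hx i (by omega)
  · rw [eq_empty_iff_forall_notMem]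
    intro x hx
    obtain ⟨o, ho⟩ := ge x
    obtain ⟨i, rfl⟩ := he o
    have := mem_iInter.1 hx i
    simp only [mem_iInter, Finset.mem_range] at this
    exact ho (this i (by omega))

end CDHProof

open CDHProof Set Filter Topology in
/-- Every homogeneous CDH space containing a copy of the Cantor set is a Baire space. -/
theorem stmt_6 {X : Type*} [TopologicalSpace X]
    (hhom : ∀ x y : X, ∃ h : X ≃ₜ X, h x = y)
    (hcdh : CDH X)
    (C : Set X) (hC : Nonempty (C ≃ₜ (ℕ → Bool))) :
    BaireSpace X := by
  by_contra hB
  obtain ⟨hsep, hD⟩ := hcdh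
  obtain ⟨φ⟩ := hC
  let f : (ℕ → Bool) → X := fun x => (φ.symm x : X)
  have hf : IsEmbedding f := IsEmbedding.subtypeVal.comp φ.symm.isEmbedding
  have q0 : (fun _ => false : ℕ → Bool) ∈ Q := ⟨∅, by simp⟩
  haveI : Nonempty X := ⟨f (fun _ => false)⟩
  obtain ⟨V, Vo, Vd, Va, Ve⟩ := exists_seq hhom hB
  -- a rich countable dense set
  choose k hk using fun m : ℕ => hhom (f (fun _ => false)) (denseSeq X m)
  have hkf : ∀ m, IsEmbedding (fun x => k m (f x)) := fun m => (k m).isEmbedding.comp hf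
  let D1 : Set X := ⋃ m, (fun x => k m (f x)) '' Q
  have D1c : D1.Countable := countable_iUnion fun m => Q_countable.image _
  have D1d : Dense D1 := by
    refine (denseRange_denseSeq X).mono ?_
    rintro _ ⟨m, rfl⟩
    exact mem_iUnion.2 ⟨m, _, q0, hk m⟩
  have P1 : ∀ d ∈ D1, ∃ S ⊆ D1, d ∉ S ∧ Disc S ∧ d ∈ closure S := by
    intro d hd
    obtain ⟨m, q, hq, rfl⟩ := mem_iUnion.1 hd
    refine ⟨(fun x => k m (f x)) '' range (CDHProof.flip q), ?_, ?_, ?_, ?_⟩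
    · rintro _ ⟨_, ⟨n, rfl⟩, rfl⟩
      exact mem_iUnion.2 ⟨m, _, Q_flip hq n, rfl⟩
    · rintro ⟨_, ⟨n, rfl⟩, h⟩
      exact flip_ne q n ((hkf m).injective h)
    · exact disc_image (hkf m) (flip_disc q)
    · exact image_closure_subset_closure_image (hkf m).continuous ⟨q, flip_closure q, rfl⟩
  -- every countable dense set has the same property
  have P : ∀ D : Set X, D.Countable → Dense D →
      ∀ d ∈ D, ∃ S ⊆ D, d ∉ S ∧ Disc S ∧ d ∈ closure S := by
    intro D Dc Dd d hd
    obtain ⟨h, rfl⟩ := hD D1 D D1c D1d Dc Dd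
    obtain ⟨c, hc, rfl⟩ := hd
    obtain ⟨S, hS, hcS, hdS, hclS⟩ := P1 c hc
    refine ⟨h '' S, image_mono hS, ?_, disc_image h.isEmbedding hdS, ?_⟩
    · rintro ⟨s, hs, e⟩
      exact hcS (h.injective e ▸ hs)
    · exact image_closure_subset_closure_image h.continuous ⟨c, hclS, rfl⟩
  -- the thin countable dense set
  have hS : ∀ n, ∃ S : Set X, S ⊆ D1 ∩ V n ∧ Disc S ∧ denseSeq X n ∈ closure S := by
    intro n
    have hd : Dense (D1 ∩ V n) := D1d.inter_of_isOpen_right (Vd n) (Vo n)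
    obtain ⟨S, h1, h2, h3, h4⟩ := P (insert (denseSeq X n) (D1 ∩ V n))
      ((D1c.mono inter_subset_left).insert _) (hd.mono (subset_insert _ _)) _ (mem_insert _ _)
    refine ⟨S, ?_, h3, h4⟩
    intro x hx
    rcases h1 hx with rfl | h
    · exact absurd hx h2
    · exact h
  choose S hSs hSd hSc using hS
  let E : Set X := ⋃ n, S n
  have Ec : E.Countable := D1c.mono (iUnion_subset fun n => (hSs n).trans inter_subset_left)
  have Ed : Dense E := by
    rw [← dense_closure]
    refine (denseRange_denseSeq X).mono ?_
    rintro _ ⟨m, rfl⟩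
    exact closure_mono (subset_iUnion S m) (hSc m)
  obtain ⟨h, hh⟩ := hD D1 E D1c D1d Ec Ed
  let g : (ℕ → Bool) → X := fun x => h (k 0 (f x))
  have hg : IsEmbedding g := h.isEmbedding.comp (hkf 0)
  have gQ : ∀ q ∈ Q, g q ∈ E := by
    intro q hq
    rw [← hh]
    exact ⟨_, mem_iUnion.2 ⟨0, q, hq, rfl⟩, rfl⟩
  obtain ⟨n, x, hx⟩ := nonempty_interior_of_iUnion_of_closed
    (f := fun n => g ⁻¹' (V n)ᶜ) (fun n => (Vo n).isClosed_compl.preimage hg.continuous) (by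
      rw [← preimage_iUnion, ← compl_iInter, Ve]; simp)
  have hdense : Dense (⋂ m, (closure (g ⁻¹' (S m)))ᶜ) :=
    dense_iInter_of_isOpen_nat (fun m => isClosed_closure.isOpen_compl)
      (fun m => disc_nowhere (disc_preimage hg.continuous hg.injective (hSd m)))
  obtain ⟨y, hyW, hy⟩ := hdense.inter_open_nonempty _ isOpen_interior ⟨x, hx⟩
  have hyc : y ∈ closure (⋃ m ∈ Finset.range n, g ⁻¹' (S m)) := by
    refine closure_mono ?_ (Q_dense.open_subset_closure_inter isOpen_interior hyW)
    rintro z ⟨hzW, hzQ⟩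
    obtain ⟨m, hm⟩ := mem_iUnion.1 (gQ z hzQ)
    have hz : g z ∉ V n := interior_subset hzW
    have : m < n := by
      by_contra hlt
      exact hz (Va (not_lt.1 hlt) (hSs m hm).2)
    exact mem_iUnion₂.2 ⟨m, Finset.mem_range.2 this, hm⟩
  rw [Finset.closure_biUnion] at hyc
  obtain ⟨m, _, hm⟩ := mem_iUnion₂.1 hyc
  exact mem_iInter.1 hy m hm
end

section
/- Let X be a topological space and κ an infinite cardinal. Then the product X^κ is either meager in itself or a Baire space. -/
theorem aux_seq {Y : Type*} [TopologicalSpace Y] {V : Set Y} (h : IsMeagre V) :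
    ∃ f : ℕ → Set Y, (∀ n, IsOpen (f n)) ∧ (∀ n, Dense (f n)) ∧ ∀ x ∈ V, ∃ n, x ∉ f n := by
  rw [IsMeagre, mem_residual_iff] at h
  obtain ⟨S, ho, hd, hc, hs⟩ := h
  obtain ⟨f, hf⟩ := (hc.insert Set.univ).exists_eq_range (Set.insert_nonempty _ _)
  have hm : ∀ n, f n = Set.univ ∨ f n ∈ S := fun n => by
    have : f n ∈ insert Set.univ S := hf ▸ Set.mem_range_self n
    simpa using this
  refine ⟨f, fun n => ?_, fun n => ?_, fun x hx => ?_⟩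
  · rcases hm n with h | h
    · rw [h]; exact isOpen_univ
    · exact ho _ h
  · rcases hm n with h | h
    · rw [h]; exact dense_univ
    · exact hd _ h
  · by_contra! hn
    refine hs (Set.mem_sInter.2 fun t ht => ?_) hx
    have : t ∈ Set.range f := hf ▸ Set.mem_insert_of_mem _ ht
    obtain ⟨n, rfl⟩ := this
    exact hn n

theorem aux_banach {Y : Type*} [TopologicalSpace Y]
    (H : ∀ U : Set Y, IsOpen U → U.Nonempty → ∃ V ⊆ U, IsOpen V ∧ V.Nonempty ∧ IsMeagre V) :
    IsMeagre (Set.univ : Set Y) := by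
  obtain ⟨M, hM⟩ := zorn_subset
    {S : Set (Set Y) | (∀ V ∈ S, IsOpen V ∧ IsMeagre V) ∧ S.PairwiseDisjoint id} (by
      intro c hc hch
      refine ⟨⋃₀ c, ⟨?_, ?_⟩, fun s hs => Set.subset_sUnion_of_mem hs⟩
      · rintro V ⟨s, hs, hV⟩
        exact (hc hs).1 V hV
      · exact (Set.pairwiseDisjoint_sUnion hch.directedOn).2 fun s hs => (hc hs).2)
  obtain ⟨hM1, hM2⟩ := hM.prop
  have hdense : Dense (⋃₀ M) := by
    rw [dense_iff_inter_open]
    intro U hU hne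
    by_contra hemp
    rw [Set.not_nonempty_iff_eq_empty] at hemp
    obtain ⟨V, hVU, hVo, ⟨y, hy⟩, hVm⟩ := H U hU hne
    have hins : insert V M ∈ {S : Set (Set Y) | (∀ V ∈ S, IsOpen V ∧ IsMeagre V) ∧
        S.PairwiseDisjoint id} := by
      refine ⟨?_, ?_⟩
      · rintro W (rfl | hW)
        · exact ⟨hVo, hVm⟩
        · exact hM1 W hW
      · refine hM2.insert fun W hW _ => ?_
        refine Set.disjoint_left.2 fun z hz hzW => ?_
        have : z ∈ U ∩ ⋃₀ M := ⟨hVU hz, W, hW, hzW⟩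
        simp [hemp] at this
    have hVM : V ∈ M := hM.le_of_ge hins (Set.subset_insert _ _) (Set.mem_insert _ _)
    have : y ∈ U ∩ ⋃₀ M := ⟨hVU hy, V, hVM, hy⟩
    simp [hemp] at this
  choose! f fo fd fe using fun V (hV : V ∈ M) => aux_seq (hM1 V hV).2
  have hres : (⋂ n, ⋃ V ∈ M, V ∩ f V n) ∈ residual Y := by
    rw [countable_iInter_mem]
    intro n
    refine residual_of_dense_open
      (isOpen_biUnion fun V hV => (hM1 V hV).1.inter (fo V hV n)) ?_
    rw [dense_iff_inter_open]
    intro U hU hne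
    obtain ⟨y, hyU, V, hV, hyV⟩ := hdense.inter_open_nonempty U hU hne
    obtain ⟨z, ⟨hzU, hzV⟩, hzf⟩ := (fd V hV n).inter_open_nonempty (U ∩ V)
      (hU.inter (hM1 V hV).1) ⟨y, hyU, hyV⟩
    exact ⟨z, hzU, Set.mem_biUnion hV ⟨hzV, hzf⟩⟩
  refine Filter.mem_of_superset hres fun x hx => ?_
  exfalso
  simp only [Set.mem_iInter, Set.mem_iUnion] at hx
  obtain ⟨V, hV, hxV, -⟩ := hx 0
  obtain ⟨n, hn⟩ := fe V hV x hxV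
  obtain ⟨W, hW, hxW, hxf⟩ := hx n
  have : V = W := hM2.elim_set hV hW x hxV hxW
  exact hn (this ▸ hxf)

theorem aux_not_baire {Y : Type*} [TopologicalSpace Y] (h : ¬ BaireSpace Y) :
    ∃ V : Set Y, IsOpen V ∧ V.Nonempty ∧ IsMeagre V := by
  by_contra! hc
  refine h ⟨fun f ho hd => ?_⟩
  rw [dense_iff_inter_open]
  intro U hU hne
  by_contra hemp
  refine hc U hU hne ?_
  have : (⋂ n, f n) ∈ residual Y :=
    countable_iInter_mem.2 fun n => residual_of_dense_open (ho n) (hd n)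
  exact Filter.mem_of_superset this fun x hx hxU => hemp ⟨x, hxU, hx⟩

/-- For any topological space `X` and any infinite index set `ι`, the product `X^ι` is
either meager in itself or a Baire space. -/
theorem stmt_9 {X : Type*} [TopologicalSpace X] (ι : Type*) [Infinite ι] :
    IsMeagre (Set.univ : Set (ι → X)) ∨ BaireSpace (ι → X) := by
  classical
  by_cases hB : BaireSpace (ι → X)
  · exact Or.inr hB
  left
  obtain ⟨W, hWo, ⟨w, hw⟩, hWm⟩ := aux_not_baire hB
  refine aux_banach fun U hU ⟨x, hx⟩ => ?_
  obtain ⟨A, u, hu, hAU⟩ := isOpen_pi_iff.1 hU x hx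
  have hcard : Cardinal.mk {i // ¬ i ∈ A} = Cardinal.mk ι :=
    Cardinal.mk_compl_finset_of_infinite A
  obtain ⟨e⟩ := Cardinal.eq.1 hcard
  let φ : ({i // ¬ i ∈ A} → X) ≃ₜ (ι → X) := Homeomorph.piCongrLeft (Y := fun _ => X) e
  let ψ := Homeomorph.piEquivPiSubtypeProd (fun i => i ∈ A) (fun _ : ι => X)
  let p : (ι → X) → (ι → X) := fun y => φ (ψ y).2
  have hpc : Continuous p := φ.continuous.comp (continuous_snd.comp ψ.continuous)
  have hpo : IsOpenMap p := φ.isOpenMap.comp (isOpenMap_snd.comp ψ.isOpenMap)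
  refine ⟨(A : Set ι).pi u ∩ p ⁻¹' W, fun y hy => hAU hy.1,
    (isOpen_set_pi A.finite_toSet fun i hi => (hu i hi).1).inter (hWo.preimage hpc),
    ⟨ψ.symm ((ψ x).1, φ.symm w), ?_, ?_⟩,
    (hWm.preimage_of_isOpenMap hpc hpo).mono Set.inter_subset_right⟩
  · intro i hi
    have h1 : (ψ (ψ.symm ((ψ x).1, φ.symm w))).1 ⟨i, hi⟩ = (ψ x).1 ⟨i, hi⟩ := by
      rw [ψ.apply_symm_apply]
    have h2 : (ψ.symm ((ψ x).1, φ.symm w)) i = x i := h1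
    rw [h2]
    exact (hu i hi).2
  · simpa [p] using hw
end

section
/- Let X be a separable Tychonoff space and κ an infinite cardinal. If X^κ is countable dense homogeneous, then X^κ is a Baire space and X is a Baire space. -/
open TopologicalSpace

open Topology Set in
theorem aux_cozero {W : Type*} [TopologicalSpace W] [CompletelyRegularSpace W] [SeparableSpace W]
    (U : Set W) (hU : IsOpen U) (hd : Dense U) :
    ∃ g : W → ℝ, Continuous g ∧ (∀ x, 0 ≤ g x) ∧ Dense {x | g x ≠ 0} ∧ ∀ x, x ∉ U → g x = 0 := by
  rcases isEmpty_or_nonempty W with hW | hW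
  · exact ⟨fun _ => 0, continuous_const, fun _ => le_rfl, fun x => (hW.false x).elim,
      fun x => (hW.false x).elim⟩
  have key : ∀ k : ℕ, ∃ f : W → ℝ, Continuous f ∧ (∀ x, 0 ≤ f x) ∧ (∀ x, f x ≤ 1) ∧
      (∀ x, x ∉ U → f x = 0) ∧ (denseSeq W k ∈ U → f (denseSeq W k) = 1) := by
    intro k
    by_cases hk : denseSeq W k ∈ U
    · obtain ⟨f, hf, h0, h1⟩ := CompletelyRegularSpace.completely_regular (denseSeq W k) Uᶜ
        hU.isClosed_compl (by simpa using hk)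
      refine ⟨fun x => 1 - (f x : ℝ), by fun_prop, fun x => ?_, fun x => ?_, fun x hx => ?_,
        fun _ => ?_⟩
      · have := (f x).2.2; linarith
      · have := (f x).2.1; linarith
      · have := h1 (show x ∈ Uᶜ from hx); simp [this]
      · simp [h0]
    · exact ⟨fun _ => 0, continuous_const, by simp, by simp, by simp, fun h => absurd h hk⟩
  choose f hfc hf0 hf1 hfU hfs using key
  have hb : ∀ k x, ‖(1/2:ℝ)^k * f k x‖ ≤ (1/2:ℝ)^k := by
    intro k x
    rw [Real.norm_of_nonneg (mul_nonneg (by positivity) (hf0 k x))]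
    exact mul_le_of_le_one_right (by positivity) (hf1 k x)
  refine ⟨fun x => ∑' k, (1/2:ℝ)^k * f k x, ?_, ?_, ?_, ?_⟩
  · exact continuous_tsum (fun k => continuous_const.mul (hfc k)) summable_geometric_two hb
  · exact fun x => tsum_nonneg fun k => mul_nonneg (by positivity) (hf0 k x)
  · have h1 : Dense (U ∩ range (denseSeq W)) :=
      hd.inter_of_isOpen_left (denseRange_denseSeq W) hU
    refine h1.mono ?_
    rintro _ ⟨hx, k, rfl⟩
    have hs : Summable fun j => (1/2:ℝ)^j * f j (denseSeq W k) :=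
      Summable.of_norm_bounded summable_geometric_two (fun j => hb j _)
    have := hs.le_tsum k (fun j _ => mul_nonneg (by positivity) (hf0 j _))
    rw [hfs k hx, mul_one] at this
    have h2 : (0:ℝ) < (1/2)^k := by positivity
    exact (lt_of_lt_of_le h2 this).ne'
  · intro x hx
    simp [hfU _ x hx]

open Topology Set in
theorem aux_nebot (x : ℕ → Bool) : Filter.NeBot (𝓝[≠] x) := by
  rw [← mem_closure_iff_nhdsWithin_neBot]
  have h : Filter.Tendsto (fun n => Function.update x n (!x n)) Filter.atTop (𝓝 x) := by
    rw [tendsto_pi_nhds]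
    intro i
    refine tendsto_const_nhds.congr' ?_
    filter_upwards [Filter.eventually_gt_atTop i] with n hn
    rw [Function.update_of_ne hn.ne]
  refine mem_closure_of_tendsto h (Filter.Eventually.of_forall fun n => ?_)
  intro hn
  have := congrFun hn n
  simp at this

open Topology Set in
/-- A countable dense set containing a dense subset of a Cantor set is not mapped by a
homeomorphism onto a countable set meeting every member of a closed cover in a finite set. -/
theorem aux_cantor {Z : Type*} [TopologicalSpace Z] (hZ : CDH Z) {κ : Type*} [Countable κ]
    (j : (ℕ → Bool) → Z) (hj : Continuous j) (hji : Function.Injective j)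
    (G : κ → Set Z) (hG : ∀ n, IsClosed (G n)) (hcov : ⋃ n, G n = univ)
    (D : Set Z) (hDc : D.Countable) (hDd : Dense D) (hfin : ∀ n, (D ∩ G n).Finite) : False := by
  obtain ⟨hsep, hh⟩ := hZ
  obtain ⟨E, hEc, hEd⟩ := exists_countable_dense (ℕ → Bool)
  obtain ⟨S, hSc, hSd⟩ := exists_countable_dense Z
  obtain ⟨h, hD⟩ := hh (S ∪ j '' E) D (hSc.union (hEc.image j)) (hSd.mono subset_union_left)
    hDc hDd
  obtain ⟨n, x, hx⟩ := nonempty_interior_of_iUnion_of_closed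
    (f := fun n => (fun t => h (j t)) ⁻¹' (G n))
    (fun n => (hG n).preimage (h.continuous.comp hj))
    (by rw [← preimage_iUnion, hcov, preimage_univ])
  have hfin2 : (E ∩ (fun t => h (j t)) ⁻¹' (G n)).Finite := by
    refine Set.Finite.of_finite_image ((hfin n).subset ?_)
      ((h.injective.comp hji).injOn)
    rintro _ ⟨t, ⟨htE, htG⟩, rfl⟩
    exact ⟨hD ▸ mem_image_of_mem h (Or.inr (mem_image_of_mem j htE)), htG⟩
  have : ∀ x : ℕ → Bool, Filter.NeBot (𝓝[≠] x) := aux_nebot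
  have hd2 := hEd.sdiff_finite hfin2
  obtain ⟨y, hy1, hy2, hy3⟩ := hd2.inter_open_nonempty _ isOpen_interior ⟨x, hx⟩
  exact hy3 ⟨hy2, interior_subset hy1⟩

open Topology Set in
theorem aux_core {W : Type*} [TopologicalSpace W] [SeparableSpace W] [Nonempty W]
    (hcdh : CDH (ℕ → W)) (g : ℕ → W → ℝ) (hgc : ∀ n, Continuous (g n))
    (hg0 : ∀ n x, 0 ≤ g n x) (hgd : ∀ n, Dense {x | g n x ≠ 0})
    (hcov : ∀ x, ∃ n, g n x = 0) : False := by
  classical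
  set s := denseSeq W with hs
  have hsd : Dense (range s) := denseRange_denseSeq W
  have hc : ∀ a, ∃ x, g a x ≠ 0 := fun a => (hgd a).nonempty
  choose c hc using hc
  -- two points and a Cantor set
  obtain ⟨w0⟩ := ‹Nonempty W›
  obtain ⟨n0, hn0⟩ := hcov w0
  have hne : w0 ≠ c n0 := fun h => hc n0 (h ▸ hn0)
  let j : (ℕ → Bool) → (ℕ → W) := fun t i => if t i then w0 else c n0
  have hj : Continuous j := by
    refine continuous_pi fun i => ?_
    exact (continuous_of_discreteTopology (f := fun b : Bool => if b then w0 else c n0)).comp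
      (continuous_apply i)
  have hji : Function.Injective j := by
    intro t t' h
    funext i
    have := congrFun h i
    simp only [j] at this
    cases h1 : t i <;> cases h2 : t' i <;> simp_all
  -- the closed cover
  let R : ℕ → ℕ → Set (ℕ → W) := fun a k =>
    {f | g a (f 0) = 0 ∧ ∀ b < a, 1 / ((k:ℝ) + 1) ≤ g b (f 0)}
  have hR : ∀ a k, IsClosed (R a k) := by
    intro a k
    have h1 : R a k = {f | g a (f 0) = 0} ∩ ⋂ b, ⋂ (_ : b < a),
        {f | 1 / ((k:ℝ) + 1) ≤ g b (f 0)} := by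
      ext f; simp [R]
    rw [h1]
    refine IsClosed.inter (isClosed_eq ((hgc a).comp (continuous_apply 0)) continuous_const) ?_
    exact isClosed_iInter fun b => isClosed_iInter fun _ =>
      isClosed_le continuous_const ((hgc b).comp (continuous_apply 0))
  let T : ℕ → ℕ → Set (ℕ → W) := fun a k => R a k ∩ {f | ∀ i, a ≤ i → g a (f i) = 0}
  let B : ℕ → ℕ → ℕ → Set (ℕ → W) := fun a k i =>
    R a k ∩ ({f | ∀ l, a ≤ l → l < i → g a (f l) = 0} ∩ {f | a ≤ i ∧ 1 / ((k:ℝ) + 1) ≤ g a (f i)})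
  let G : (ℕ × ℕ) ⊕ (ℕ × ℕ × ℕ) → Set (ℕ → W) :=
    Sum.elim (fun p => T p.1 p.2) (fun p => B p.1 p.2.1 p.2.2)
  have hclz : ∀ a i, IsClosed {f : ℕ → W | g a (f i) = 0} := fun a i =>
    isClosed_eq ((hgc a).comp (continuous_apply i)) continuous_const
  have hG : ∀ n, IsClosed (G n) := by
    rintro (⟨a, k⟩ | ⟨a, k, i⟩)
    · refine (hR a k).inter ?_
      simp only [ofPred_forall]
      exact isClosed_iInter fun i => isClosed_iInter fun _ => hclz a i
    · refine (hR a k).inter (IsClosed.inter ?_ ?_)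
      · simp only [ofPred_forall]
        exact isClosed_iInter fun i => isClosed_iInter fun _ => isClosed_iInter fun _ => hclz a i
      · exact isClosed_const.inter
          (isClosed_le continuous_const ((hgc a).comp (continuous_apply i)))
  have hpos : ∀ n x, g n x ≠ 0 → ∃ K : ℕ, ∀ k ≥ K, 1 / ((k:ℝ) + 1) ≤ g n x := by
    intro n x hx
    obtain ⟨K, hK⟩ := exists_nat_one_div_lt (lt_of_le_of_ne (hg0 n x) (Ne.symm hx))
    refine ⟨K, fun k hk => le_trans ?_ hK.le⟩
    have : (K:ℝ) ≤ k := by exact_mod_cast hk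
    gcongr
  have hneg : ∀ n x (k : ℕ), 1 / ((k:ℝ) + 1) ≤ g n x → g n x ≠ 0 := by
    intro n x k h h0
    have : (0:ℝ) < 1 / ((k:ℝ) + 1) := by positivity
    linarith
  have hGcov : ⋃ n, G n = univ := by
    refine eq_univ_of_forall fun f => ?_
    have ha := Nat.find_spec (hcov (f 0))
    have hb := fun b (h : b < Nat.find (hcov (f 0))) => Nat.find_min (hcov (f 0)) h
    set a := Nat.find (hcov (f 0))
    have hK1 : ∃ K : ℕ, ∀ b < a, ∀ k ≥ K, 1 / ((k:ℝ) + 1) ≤ g b (f 0) := by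
      have : ∀ b, ∃ K : ℕ, b < a → ∀ k ≥ K, 1 / ((k:ℝ) + 1) ≤ g b (f 0) := by
        intro b
        by_cases h : b < a
        · obtain ⟨K, hK⟩ := hpos b (f 0) (hb b h)
          exact ⟨K, fun _ => hK⟩
        · exact ⟨0, fun h' => absurd h' h⟩
      choose K hK using this
      refine ⟨(Finset.range a).sup K, fun b hba k hk => hK b hba k (le_trans ?_ hk)⟩
      exact Finset.le_sup (f := K) (Finset.mem_range.2 hba)
    obtain ⟨K1, hK1⟩ := hK1
    by_cases hT : ∀ i, a ≤ i → g a (f i) = 0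
    · exact mem_iUnion.2 ⟨Sum.inl (a, K1), ⟨ha, fun b h => hK1 b h K1 le_rfl⟩, hT⟩
    · push Not at hT
      have hi := Nat.find_spec hT
      have hm := fun l (h : l < Nat.find hT) => Nat.find_min hT h
      set i := Nat.find hT
      obtain ⟨K2, hK2⟩ := hpos a (f i) hi.2
      refine mem_iUnion.2 ⟨Sum.inr (a, max K1 K2, i),
        ⟨ha, fun b h => hK1 b h _ (le_max_left _ _)⟩, ?_, hi.1, hK2 _ (le_max_right _ _)⟩
      intro l hal hli
      by_contra h0
      exact hm l hli ⟨hal, h0⟩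
  -- the dense set
  let e : List ℕ → ℕ → W := fun q i => s (q.getD i (q.headD 0))
  let D : Set (ℕ → W) := {f | ∃ q i a, f = Function.update (e q) i (c a) ∧
    Encodable.encode q ≤ i ∧ g a (e q 0) = 0 ∧ (∀ b < a, g b (e q 0) ≠ 0) ∧
    q.length ≤ a ∧ a ≤ i ∧ 1 ≤ i}
  have hDc : D.Countable := by
    refine (countable_range (fun p : List ℕ × ℕ × ℕ =>
      Function.update (e p.1) p.2.1 (c p.2.2))).mono ?_
    rintro f ⟨q, i, a, rfl, -⟩
    exact ⟨(q, i, a), rfl⟩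
  have he0 : ∀ q i, q.length ≤ i → e q i = e q 0 := by
    intro q i h
    simp only [e]
    congr 1
    rw [List.getD_eq_default _ _ h]
    cases q <;> simp
  have hrank : ∀ (x : W) (a a' : ℕ), g a x = 0 → (∀ b < a, g b x ≠ 0) → g a' x = 0 →
      (∀ b < a', g b x ≠ 0) → a = a' := by
    intro x a a' h1 h2 h3 h4
    rcases lt_trichotomy a a' with h | h | h
    · exact absurd h1 (h4 a h)
    · exact h
    · exact absurd h3 (h2 a' h)
  have hfin : ∀ n, (D ∩ G n).Finite := by
    rintro (⟨a, k⟩ | ⟨a, k, i⟩)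
    · convert finite_empty
      rw [eq_empty_iff_forall_notMem]
      rintro f ⟨⟨q, i, a', rfl, h1, h2, h3, h4, h5, h6⟩, ⟨h7, h8⟩, h9⟩
      rw [Function.update_of_ne (by omega)] at h7 h8
      obtain rfl := hrank _ a a' h7 (fun b hb => hneg _ _ _ (h8 b hb)) h2 h3
      have := h9 i h5
      rw [Function.update_self] at this
      exact hc a this
    · have hf1 : {q : List ℕ | Encodable.encode q ≤ i}.Finite :=
        Set.Finite.of_finite_image ((finite_Iic i).subset (image_subset_iff.2 fun q hq => hq))
          (Encodable.encode_injective.injOn)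
      refine (hf1.image (fun q => Function.update (e q) i (c a))).subset ?_
      rintro f ⟨⟨q, i', a', rfl, h1, h2, h3, h4, h5, h6⟩, ⟨h7, h8⟩, h9, h10, h11⟩
      rw [Function.update_of_ne (by omega)] at h7 h8
      obtain rfl := hrank _ a a' h7 (fun b hb => hneg _ _ _ (h8 b hb)) h2 h3
      have h10 : a ≤ i := h10
      have hii : i = i' := by
        rcases lt_trichotomy i i' with h | h | h
        · rw [Function.update_of_ne h.ne, he0 q i (by omega)] at h11
          exact absurd h2 (hneg _ _ _ h11)
        · exact h
        · have := h9 i' h5 h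
          rw [Function.update_self] at this
          exact absurd this (hc a)
      subst hii
      exact ⟨q, h1, rfl⟩
  have hDd : Dense D := by
    rw [dense_iff_inter_open]
    rintro O hO ⟨x, hx⟩
    obtain ⟨I, u, hu, hsub⟩ := isOpen_pi_iff.1 hO x hx
    obtain ⟨m, hm⟩ : ∃ m, ∀ i ∈ I, i < m := ⟨I.sup id + 1, fun i hi =>
      Nat.lt_succ_of_le (Finset.le_sup (f := id) hi)⟩
    have hUd : ∀ m : ℕ, Dense {x | ∀ b < m, g b x ≠ 0} ∧ IsOpen {x | ∀ b < m, g b x ≠ 0} := by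
      intro m
      induction m with
      | zero => simp
      | succ m ih =>
        have h1 : {x | ∀ b < m + 1, g b x ≠ 0} = {x | ∀ b < m, g b x ≠ 0} ∩ {x | g m x ≠ 0} := by
          ext x
          simp only [Nat.lt_succ_iff_lt_or_eq, mem_setOf_eq, mem_inter_iff, or_imp, forall_and,
            forall_eq]
        rw [h1]
        exact ⟨ih.1.inter_of_isOpen_left (hgd m) ih.2,
          ih.2.inter (isOpen_ne_fun (hgc m) continuous_const)⟩
    have hn : ∀ l, ∃ n, (l ∈ I → s n ∈ u l) ∧ (∀ b < m + 1, g b (s n) ≠ 0) := by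
      intro l
      have hV : IsOpen (if l ∈ I then u l else univ) ∧ (if l ∈ I then u l else univ).Nonempty := by
        split_ifs with h
        · exact ⟨(hu l h).1, x l, (hu l h).2⟩
        · exact ⟨isOpen_univ, w0, trivial⟩
      have h2 := (hUd (m+1)).1.inter_open_nonempty _ hV.1 hV.2
      obtain ⟨_, hy, n, rfl⟩ := hsd.inter_open_nonempty _ (hV.1.inter (hUd (m+1)).2) h2
      refine ⟨n, fun h => ?_, hy.2⟩
      have := hy.1
      rwa [if_pos h] at this
    choose n hn1 hn2 using hn
    let q := (List.range (m+1)).map n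
    have hql : q.length = m + 1 := by simp [q]
    have hqe : ∀ l, l < m + 1 → e q l = s (n l) := by
      intro l hl
      simp only [e]
      congr 1
      rw [List.getD_eq_getElem _ _ (by omega)]
      simp [q]
    have ha := Nat.find_spec (hcov (e q 0))
    have hb := fun b (h : b < Nat.find (hcov (e q 0))) => Nat.find_min (hcov (e q 0)) h
    set a := Nat.find (hcov (e q 0))
    have ham : m + 1 ≤ a := by
      by_contra h
      rw [hqe 0 (by omega)] at ha
      exact hn2 0 a (by omega) ha
    refine ⟨Function.update (e q) (max (Encodable.encode q) a) (c a), hsub ?_, q, _, a, rfl,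
      le_max_left _ _, ha, hb, by omega, le_max_right _ _, by omega⟩
    intro l hl
    have hlm := hm l hl
    rw [Function.update_of_ne (by omega), hqe l (by omega)]
    exact hn1 l hl
  exact aux_cantor hcdh j hj hji G hG hGcov D hDc hDd hfin

open Topology Set in
theorem aux_homeo {Y Z : Type*} [TopologicalSpace Y] [TopologicalSpace Z] (φ : Y ≃ₜ Z)
    (h : CDH Y) : CDH Z := by
  obtain ⟨hs, hh⟩ := h
  refine ⟨φ.surjective.denseRange.separableSpace φ.continuous, fun D D' hc hd hc' hd' => ?_⟩
  obtain ⟨k, hk⟩ := hh (φ.symm '' D) (φ.symm '' D') (hc.image _)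
    (φ.symm.surjective.denseRange.dense_image φ.symm.continuous hd) (hc'.image _)
    (φ.symm.surjective.denseRange.dense_image φ.symm.continuous hd')
  refine ⟨(φ.symm.trans k).trans φ, ?_⟩
  have : (φ ∘ (k ∘ φ.symm)) '' D = D' := by
    rw [image_comp, image_comp, hk, ← image_comp]
    simp
  exact this

theorem aux_powHomeo (X : Type*) [TopologicalSpace X] (ι : Type*) [Infinite ι] :
    Nonempty ((ι → X) ≃ₜ (ℕ → ι → X)) := by
  have : Nonempty (ℕ × ι ≃ ι) := by
    rw [← Cardinal.lift_mk_eq']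
    simp
  obtain ⟨e⟩ := this
  exact ⟨{ toFun := fun f n i => f (e (n, i))
           invFun := fun f i => f (e.symm i).1 (e.symm i).2
           left_inv := fun f => by funext i; simp
           right_inv := fun f => by funext n i; simp
           continuous_toFun := by fun_prop
           continuous_invFun := by fun_prop }⟩

open Topology Set in
theorem aux_completelyRegular_pi {X : Type*} [TopologicalSpace X] [CompletelyRegularSpace X]
    (ι : Type*) : CompletelyRegularSpace (ι → X) := by
  obtain ⟨u, hu⟩ := CompletelyRegularSpace.exists_uniformSpace (X := X)
  subst hu
  infer_instance

open Topology Set in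
theorem aux_baire {Y : Type*} [TopologicalSpace Y] [CompletelyRegularSpace Y]
    (hcdh : CDH Y) (φ : Y ≃ₜ (ℕ → Y)) : BaireSpace Y := by
  classical
  have hsep : SeparableSpace Y := hcdh.1
  refine ⟨fun f ho hd => ?_⟩
  by_contra hnd
  rw [dense_iff_inter_open] at hnd
  push Not at hnd
  obtain ⟨V, hVo, ⟨v, hv⟩, hVe⟩ := hnd
  have : Nonempty Y := ⟨v⟩
  -- dense open sets of the power with empty intersection
  let U : Option (ℕ × ℕ) → Set (ℕ → Y) := fun o =>
    o.elim {x | ∃ i, x i ∈ V} (fun p => {x | x p.1 ∈ f p.2})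
  have hUo : ∀ o, IsOpen (U o) := by
    rintro (_ | ⟨i, n⟩)
    · change IsOpen {x : ℕ → Y | ∃ i, x i ∈ V}
      rw [ofPred_exists]
      exact isOpen_iUnion fun i => hVo.preimage (continuous_apply i)
    · exact (ho n).preimage (continuous_apply i)
  have hUd : ∀ o, Dense (U o) := by
    rintro (_ | ⟨i, n⟩)
    · rw [dense_iff_inter_open]
      rintro O hO ⟨x, hx⟩
      obtain ⟨I, u, hu, hsub⟩ := isOpen_pi_iff.1 hO x hx
      obtain ⟨i, hi⟩ := Infinite.exists_notMem_finset I
      refine ⟨Function.update x i v, hsub fun l hl => ?_, i, by simpa using hv⟩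
      have hli : l ≠ i := by
        rintro rfl
        exact hi hl
      rw [Function.update_of_ne hli]
      exact (hu l hl).2
    · exact (hd n).preimage (isOpenMap_eval i)
  have hUe : ∀ x, ∃ o, x ∉ U o := by
    intro x
    by_contra! h
    obtain ⟨i, hi⟩ := h none
    have : x i ∈ V ∩ ⋂ n, f n := ⟨hi, mem_iInter.2 fun n => h (some (i, n))⟩
    rw [hVe] at this
    exact this
  let ε : ℕ ≃ Option (ℕ × ℕ) := (Denumerable.eqv (Option (ℕ × ℕ))).symm
  have hU2 : ∀ n, ∃ g : Y → ℝ, Continuous g ∧ (∀ x, 0 ≤ g x) ∧ Dense {x | g x ≠ 0} ∧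
      ∀ x, x ∉ φ ⁻¹' U (ε n) → g x = 0 := fun n =>
    aux_cozero _ ((hUo _).preimage φ.continuous) ((hUd _).preimage φ.isOpenMap)
  choose g hg1 hg2 hg3 hg4 using hU2
  refine aux_core (aux_homeo φ hcdh) g hg1 hg2 hg3 fun x => ?_
  obtain ⟨o, ho⟩ := hUe (φ x)
  exact ⟨ε.symm o, hg4 _ _ (by simpa using ho)⟩

/-- If `X` is a separable Tychonoff space, `ι` is infinite and `X^ι` is CDH, then
`X^ι` and `X` are Baire spaces. -/
theorem stmt_11 {X : Type*} [TopologicalSpace X] [T35Space X] [SeparableSpace X]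
    (ι : Type*) [Infinite ι] (hcdh : CDH (ι → X)) :
    BaireSpace (ι → X) ∧ BaireSpace X := by
  have hcr := aux_completelyRegular_pi (X := X) ι
  obtain ⟨φ⟩ := aux_powHomeo X ι
  have hB : BaireSpace (ι → X) := aux_baire hcdh φ
  refine ⟨hB, ?_⟩
  rcases isEmpty_or_nonempty X with hX | hX
  · exact ⟨fun f _ _ x => (hX.false x).elim⟩
  · obtain ⟨i⟩ : Nonempty ι := inferInstance
    have hq : IsOpenQuotientMap (fun f : ι → X => f i) :=
      ⟨Function.surjective_eval i, continuous_apply i, isOpenMap_eval i⟩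
    exact hq.baireSpace
end
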